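/- Let X be a simplicial complex of rank n ≥ 1. If X is an n-PCM or an n-surface, then X is a pseudomanifold of rank n. -/

import Mathlib

namespace PCMPaper

variable {α : Type*} [PartialOrder α]

/-- The set of elements of `X` strictly below `h` (α□_X(h)). -/
def alphaS (X : Set α) (h : α) : Set α := {x ∈ X | x < h}

/-- The set of elements of `X` strictly above `h` (β□_X(h)). -/
def betaS (X : Set α) (h : α) : Set α := {x ∈ X | h < x}

/-- The (strict) neighborhood θ□_X(h) = α□_X(h) ∪ β□_X(h). -/
def thetaS (X : Set α) (h : α) : Set α := alphaS X h ∪ betaS X h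

/-- The rank of `h` in the poset `X`: the maximal length of a strictly increasing
chain in `X` ending at `h`.  (It equals 0 when α□_X(h) = ∅ and
`max_{x ∈ α□_X(h)} rank X x + 1` otherwise, for finite `X`.) -/
noncomputable def rank (X : Set α) (h : α) : ℕ :=
  sSup {n : ℕ | ∃ c : Fin (n + 1) → α, StrictMono c ∧ (∀ i, c i ∈ X) ∧ c (Fin.last n) = h}

open scoped Classical in
/-- The rank of the poset `X`: maximal rank of its elements, `-1` if empty. -/
noncomputable def rankSet (X : Set α) : ℤ :=
  if X = ∅ then -1 else ((sSup (rank X '' X) : ℕ) : ℤ)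

/-- One step of a path in `X`: two distinct comparable elements of `X`. -/
def rel (X : Set α) (x y : α) : Prop :=
  x ∈ X ∧ y ∈ X ∧ x ≠ y ∧ (x < y ∨ y < x)

/-- `X` is (path-)connected: any two elements are joined by a path in `X`. -/
def IsConnected (X : Set α) : Prop :=
  ∀ x ∈ X, ∀ y ∈ X, Relation.ReflTransGen (rel X) x y

/-- `IsSurfaceAux (k + 1) X` means that `X` is a (discrete) `k`-surface. -/
def IsSurfaceAux : ℕ → Set α → Prop
  | 0, X => X = ∅
  | 1, X => ∃ x y : α, x ≠ y ∧ ¬ x < y ∧ ¬ y < x ∧ X = {x, y}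
  | (n + 2), X => X.Nonempty ∧ IsConnected X ∧ ∀ h ∈ X, IsSurfaceAux (n + 1) (thetaS X h)

/-- `X` is a discrete `k`-surface (`k : ℤ`, `k ≥ -1`). -/
def IsSurface (k : ℤ) (X : Set α) : Prop :=
  ∃ n : ℕ, (n : ℤ) = k + 1 ∧ IsSurfaceAux n X

/-- The border ΔX of a poset `X` of rank `n`:
elements whose neighborhood is not an `(n-1)`-surface. -/
def border (X : Set α) : Set α :=
  {h ∈ X | ¬ IsSurface (rankSet X - 1) (thetaS X h)}

/-- The interior of `X`. -/
def interior' (X : Set α) : Set α := X \ border X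

/-- `IsPCMAux (n + 1) X` means that `X` is an `n`-PCM. -/
def IsPCMAux : ℕ → Set α → Prop
  | 0, X => X = ∅
  | 1, X => ∃ x : α, X = {x}
  | (n + 2), X => rankSet X = ((n : ℤ) + 1) ∧ IsConnected X ∧ border X ≠ ∅ ∧
      ∀ h ∈ X, (h ∈ border X → IsPCMAux (n + 1) (thetaS X h)) ∧
               (h ∉ border X → IsSurfaceAux (n + 1) (thetaS X h))

/-- `X` is an `k`-PCM (`k : ℤ`, `k ≥ -1`). -/
def IsPCM (k : ℤ) (X : Set α) : Prop :=
  ∃ n : ℕ, (n : ℤ) = k + 1 ∧ IsPCMAux n X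

/-- Fuel-indexed coherence. -/
def IsCoherentAux : ℕ → Set α → Prop
  | 0, X => X = ∅
  | (n + 1), X => X = ∅ ∨
      ∀ h ∈ X, rankSet (thetaS X h) = rankSet X - 1 ∧ IsCoherentAux n (thetaS X h)

/-- `X` is a coherent poset. -/
def IsCoherent (X : Set α) : Prop := ∃ n : ℕ, IsCoherentAux n X

/-- `X` is a separated union of `(m-1)`-surfaces: a union of `(m-1)`-surfaces such
that no element of one of them is comparable to an element of another one. -/
def IsSeparatedUnionOfSurfacesAux (m : ℕ) (X : Set α) : Prop :=
  ∃ P : Set (Set α), P.Nonempty ∧ X = ⋃₀ P ∧ (∀ S ∈ P, IsSurfaceAux m S) ∧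
    ∀ S ∈ P, ∀ T ∈ P, S ≠ T → ∀ x ∈ S, ∀ y ∈ T, ¬ x ≤ y ∧ ¬ y ≤ x

/-- `IsSmoothPCMAux (n + 1) X` means that `X` is a smooth `n`-PCM. -/
def IsSmoothPCMAux : ℕ → Set α → Prop
  | 0, X => X = ∅
  | 1, X => ∃ x : α, X = {x}
  | (n + 2), X => rankSet X = ((n : ℤ) + 1) ∧ IsConnected X ∧ border X ≠ ∅ ∧
      IsSeparatedUnionOfSurfacesAux (n + 1) (border X) ∧
      ∀ h ∈ X, IsSurfaceAux (n + 1) (thetaS X h) ∨ IsSmoothPCMAux (n + 1) (thetaS X h)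

/-- `X` is a smooth `k`-PCM (`k : ℤ`, `k ≥ -1`). -/
def IsSmoothPCM (k : ℤ) (X : Set α) : Prop :=
  ∃ n : ℕ, (n : ℤ) = k + 1 ∧ IsSmoothPCMAux n X

/-- A simplicial complex: a finite family of nonempty finite sets, closed under
taking nonempty subsets and under nonempty intersections. -/
def IsSimplicialComplex {V : Type*} [DecidableEq V] (X : Set (Finset V)) : Prop :=
  X.Finite ∧ (∀ h ∈ X, h.Nonempty) ∧
  (∀ h ∈ X, ∀ h' : Finset V, h'.Nonempty → h' ⊆ h → h' ∈ X) ∧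
  (∀ h ∈ X, ∀ h' ∈ X, (h ∩ h').Nonempty → h ∩ h' ∈ X)

/-- The dimension of a simplex. -/
def dim {V : Type*} (h : Finset V) : ℤ := (h.card : ℤ) - 1

/-- The link of a simplex `h` in a family of simplices `S`. -/
def link {V : Type*} [DecidableEq V] (h : Finset V) (S : Set (Finset V)) : Set (Finset V) :=
  {h' ∈ S | h ∩ h' = ∅ ∧ h ∪ h' ∈ S}

/-- `X` is pure of rank `n`: every simplex is contained in an `n`-dimensional one. -/
def Pure {V : Type*} (X : Set (Finset V)) (n : ℤ) : Prop :=
  ∀ h ∈ X, ∃ g ∈ X, h ⊆ g ∧ dim g = n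

/-- Any two `n`-simplices of `X` are joined by a path in `X` all of whose elements
are simplices of dimension `n - 1` or `n` (i.e. `X` is `(n-1)`-connected). -/
def NConnected {V : Type*} (X : Set (Finset V)) (n : ℤ) : Prop :=
  ∀ a ∈ X, dim a = n → ∀ b ∈ X, dim b = n →
    Relation.ReflTransGen (rel {h | h ∈ X ∧ (dim h = n - 1 ∨ dim h = n)}) a b

/-- `X` is a pseudomanifold of rank `n`. -/
def IsPseudomanifold {V : Type*} [DecidableEq V] (X : Set (Finset V)) (n : ℤ) : Prop :=
  IsSimplicialComplex X ∧ rankSet X = n ∧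
  ((n = 0 ∧ ∃ v : V, X = {({v} : Finset V)}) ∨
   (1 ≤ n ∧ Pure X n ∧
    (∀ h ∈ X, dim h = n - 1 →
      Set.ncard {g | g ∈ X ∧ h ⊆ g ∧ dim g = n} ∈ ({1, 2} : Set ℕ)) ∧
    NConnected X n))

/-- `X` is a normal pseudomanifold of rank `n`: a pseudomanifold such that the link
of every simplex of dimension at most `n - 2` is a pseudomanifold. -/
def IsNormalPseudomanifold {V : Type*} [DecidableEq V] (X : Set (Finset V)) (n : ℤ) : Prop :=
  IsPseudomanifold X n ∧
  ∀ h ∈ X, dim h ≤ n - 2 → IsPseudomanifold (link h X) (n - dim h - 1)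

/-- A common weakening of surfaces and PCMs that is inherited by strict neighborhoods. -/
def IsThinAux : ℕ → Set α → Prop
  | 0, X => X = ∅
  | 1, X => (∃ x : α, X = {x}) ∨ ∃ x y : α, x ≠ y ∧ ¬ x < y ∧ ¬ y < x ∧ X = {x, y}
  | (n + 2), X => X.Nonempty ∧ IsConnected X ∧ ∀ h ∈ X, IsThinAux (n + 1) (thetaS X h)

theorem IsSurfaceAux.isThinAux : ∀ {n : ℕ} {X : Set α}, IsSurfaceAux n X → IsThinAux n X
  | 0, _, h => h
  | 1, _, h => Or.inr h
  | _ + 2, _, h => ⟨h.1, h.2.1, fun x hx => (h.2.2 x hx).isThinAux⟩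

theorem IsPCMAux.isThinAux : ∀ {n : ℕ} {X : Set α}, IsPCMAux n X → IsThinAux n X
  | 0, _, h => h
  | 1, _, h => Or.inl h
  | n + 2, X, h => by
    obtain ⟨_, hc, hb, ht⟩ := h
    refine ⟨(Set.nonempty_iff_ne_empty.2 hb).mono fun x hx => hx.1, hc, fun x hx => ?_⟩
    by_cases hxb : x ∈ border X
    · exact ((ht x hx).1 hxb).isThinAux
    · exact ((ht x hx).2 hxb).isThinAux

theorem mem_thetaS {X : Set α} {h x : α} : x ∈ thetaS X h ↔ x ∈ X ∧ (x < h ∨ h < x) := by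
  simp only [thetaS, alphaS, betaS, Set.mem_union, Set.mem_ofPred_eq]
  tauto

theorem thetaS_subset (X : Set α) (h : α) : thetaS X h ⊆ X := fun _ hx => (mem_thetaS.1 hx).1

theorem notMem_thetaS (X : Set α) (h : α) : h ∉ thetaS X h :=
  fun hh => (mem_thetaS.1 hh).2.elim (lt_irrefl h) (lt_irrefl h)

theorem IsThinAux.thetaS : ∀ {n : ℕ} {X : Set α}, IsThinAux (n + 1) X →
    ∀ {h : α}, h ∈ X → IsThinAux n (thetaS X h)
  | 0, X, hX, h, hh => by
    refine Set.eq_empty_of_forall_notMem fun z hz => ?_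
    obtain ⟨hzX, hzh⟩ := mem_thetaS.1 hz
    obtain ⟨x, rfl⟩ | ⟨x, y, -, h1, h2, rfl⟩ := hX
    · obtain rfl : h = x := hh
      obtain rfl : z = h := hzX
      exact hzh.elim (lt_irrefl _) (lt_irrefl _)
    · rcases hh with rfl | rfl <;> rcases hzX with rfl | rfl <;> simp_all
  | _ + 1, _, hX, h, hh => hX.2.2 h hh

theorem IsThinAux.nonempty : ∀ {n : ℕ} {X : Set α}, IsThinAux (n + 1) X → X.Nonempty
  | 0, _, .inl ⟨x, hx⟩ => ⟨x, hx ▸ rfl⟩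
  | 0, _, .inr ⟨x, _, _, _, _, hx⟩ => ⟨x, hx ▸ Or.inl rfl⟩
  | _ + 1, _, h => h.1

/-- The elements of `X` strictly comparable to every element of `C`. -/
def chainNbhd (X : Set α) (C : Finset α) : Set α := {x ∈ X | ∀ c ∈ C, x < c ∨ c < x}

/-- `C` is a chain of `X` with `n` elements. -/
def IsChainOfCard (n : ℕ) (X : Set α) (C : Finset α) : Prop :=
  (C : Set α) ⊆ X ∧ IsChain (· < ·) (C : Set α) ∧ C.card = n

theorem IsChainOfCard.insert_of_mem_chainNbhd [DecidableEq α] {n : ℕ} {X : Set α} {C : Finset α} {x : α}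
    (hC : IsChainOfCard n X C) (hx : x ∈ chainNbhd X C) :
    IsChainOfCard (n + 1) X (insert x C) := by
  refine ⟨?_, ?_, ?_⟩
  · rw [Finset.coe_insert]
    exact Set.insert_subset hx.1 hC.1
  · rw [Finset.coe_insert]
    exact hC.2.1.insert fun c hc _ => hx.2 c hc
  · rw [Finset.card_insert_of_notMem, hC.2.2]
    intro h
    simpa using hx.2 x h

theorem IsChainOfCard.insert_of_thetaS [DecidableEq α] {n : ℕ} {X : Set α} {C : Finset α} {x : α}
    (hx : x ∈ X) (hC : IsChainOfCard n (thetaS X x) C) : IsChainOfCard (n + 1) X (insert x C) :=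
  IsChainOfCard.insert_of_mem_chainNbhd ⟨hC.1.trans (thetaS_subset X x), hC.2⟩
    ⟨hx, fun _ hc => (mem_thetaS.1 (hC.1 hc)).2.symm⟩

theorem IsChainOfCard.erase [DecidableEq α] {n : ℕ} {X : Set α} {C : Finset α} {x : α}
    (hC : IsChainOfCard (n + 1) X C) (hx : x ∈ C) : IsChainOfCard n (thetaS X x) (C.erase x) := by
  refine ⟨fun c hc => ?_, hC.2.1.mono (by simp), ?_⟩
  · rw [Finset.mem_coe, Finset.mem_erase] at hc
    exact mem_thetaS.2 ⟨hC.1 hc.2, hC.2.1 hc.2 hx hc.1⟩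
  · rw [Finset.card_erase_of_mem hx, hC.2.2, Nat.add_sub_cancel]

theorem IsThinAux.chainNbhd {k m : ℕ} {X : Set α} {C : Finset α} (hX : IsThinAux (k + m) X)
    (hC : IsChainOfCard m X C) : IsThinAux k (chainNbhd X C) := by
  classical
  induction m generalizing X C with
  | zero =>
    obtain rfl := Finset.card_eq_zero.1 hC.2.2
    simpa [PCMPaper.chainNbhd] using hX
  | succ m ih =>
    obtain ⟨x, hx⟩ : C.Nonempty := Finset.card_pos.1 (by have := hC.2.2; omega)
    have := ih (hX.thetaS (hC.1 hx)) (hC.erase hx)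
    convert this using 1
    ext y
    simp only [PCMPaper.chainNbhd, Set.mem_ofPred_eq, mem_thetaS, Finset.mem_erase]
    constructor
    · exact fun h => ⟨⟨h.1, h.2 x hx⟩, fun c hc => h.2 c hc.2⟩
    · refine fun h => ⟨h.1.1, fun c hc => ?_⟩
      by_cases hcx : c = x
      · exact hcx ▸ h.1.2
      · exact h.2 c ⟨hcx, hc⟩

theorem IsThinAux.card_le {n m : ℕ} {X : Set α} {C : Finset α} (hX : IsThinAux n X)
    (hC : IsChainOfCard m X C) : m ≤ n := by
  classical
  induction n generalizing X C m with
  | zero =>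
    obtain rfl : X = ∅ := hX
    have := hC.2.2
    rw [Finset.coe_eq_empty.1 (Set.subset_empty_iff.1 hC.1), Finset.card_empty] at this
    omega
  | succ n ih =>
    obtain _ | m := m
    · exact Nat.zero_le _
    obtain ⟨x, hx⟩ : C.Nonempty := Finset.card_pos.1 (by have := hC.2.2; omega)
    exact Nat.succ_le_succ (ih (hX.thetaS (hC.1 hx)) (hC.erase hx))

theorem IsThinAux.exists_chain_superset {k m : ℕ} {X : Set α} {C : Finset α}
    (hX : IsThinAux (k + m) X) (hC : IsChainOfCard m X C) :
    ∃ D, C ⊆ D ∧ IsChainOfCard (k + m) X D := by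
  classical
  induction k generalizing m C with
  | zero => exact ⟨C, subset_rfl, by rwa [Nat.zero_add]⟩
  | succ k ih =>
    obtain ⟨x, hx⟩ := (hX.chainNbhd hC).nonempty
    rw [Nat.add_right_comm, Nat.add_assoc] at hX ⊢
    obtain ⟨D, hD, hD'⟩ := ih hX (hC.insert_of_mem_chainNbhd hx)
    exact ⟨D, (Finset.subset_insert x C).trans hD, hD'⟩

/-- Two chains of `X` with `n` elements having at least `n - 1` elements in common. -/
def AdjChains (n : ℕ) (X : Set α) (C D : Finset α) : Prop :=
  IsChainOfCard n X C ∧ IsChainOfCard n X D ∧ ∃ E, E ⊆ C ∧ E ⊆ D ∧ n ≤ E.card + 1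

theorem IsThinAux.reflTransGen_adjChains {n : ℕ} {X : Set α} (hX : IsThinAux n X)
    {C D : Finset α} (hC : IsChainOfCard n X C) (hD : IsChainOfCard n X D) :
    Relation.ReflTransGen (AdjChains n X) C D := by
  classical
  induction n generalizing X C D with
  | zero => exact .single ⟨hC, hD, ∅, by simp⟩
  | succ n ih =>
    obtain _ | n := n
    · exact .single ⟨hC, hD, ∅, by simp⟩
    have common : ∀ {x C D}, x ∈ C → x ∈ D → IsChainOfCard (n + 2) X C →
        IsChainOfCard (n + 2) X D → Relation.ReflTransGen (AdjChains (n + 2) X) C D := by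
      intro x C D hxC hxD hC hD
      have hx := hC.1 hxC
      have := (ih (hX.thetaS hx) (IsChainOfCard.erase hC hxC) (IsChainOfCard.erase hD hxD)).lift
        (p := AdjChains (n + 2) X) (insert x) ?_
      · rwa [Function.onFun, Finset.insert_erase hxC, Finset.insert_erase hxD] at this
      · rintro A B ⟨hA, hB, E, hEA, hEB, hE⟩
        refine ⟨IsChainOfCard.insert_of_thetaS hx hA, IsChainOfCard.insert_of_thetaS hx hB, insert x E,
          Finset.insert_subset_insert x hEA, Finset.insert_subset_insert x hEB, ?_⟩
        rw [Finset.card_insert_of_notMem fun h => notMem_thetaS X x (hA.1 (hEA h))]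
        omega
    obtain ⟨c, hc⟩ : C.Nonempty := Finset.card_pos.1 (by have := hC.2.2; omega)
    obtain ⟨d, hd⟩ : D.Nonempty := Finset.card_pos.1 (by have := hD.2.2; omega)
    have path := hX.2.1 c (hC.1 hc) d (hD.1 hd)
    clear ih
    induction path generalizing D with
    | refl => exact common hc hd hC hD
    | @tail y z _ hyz ih =>
      obtain ⟨hy, hz, hne, hlt⟩ := hyz
      have hyz' : IsChainOfCard 2 X {y, z} := by
        refine ⟨?_, ?_, Finset.card_pair hne⟩
        · rw [Finset.coe_pair]
          exact Set.pair_subset hy hz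
        · rw [Finset.coe_pair]
          rintro a (rfl | rfl) b (rfl | rfl) hab <;> tauto
      obtain ⟨E, hE, hE'⟩ := IsThinAux.exists_chain_superset (m := 2) hX hyz'
      exact (ih hE' (hE (by simp))).trans (common (hE (by simp)) hd hE' hD)

section Finset

variable {V : Type*}

theorem IsChainOfCard.exists_card_eq {m j : ℕ} {X : Set (Finset V)} {C : Finset (Finset V)}
    (hC : IsChainOfCard m X C) (hpos : ∀ c ∈ C, c.Nonempty) (hle : ∀ c ∈ C, c.card ≤ m)
    (hj : 1 ≤ j) (hjm : j ≤ m) : ∃ c ∈ C, c.card = j := by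
  have himg : C.image Finset.card = Finset.Icc 1 m := by
    refine Finset.eq_of_subset_of_card_le (fun i hi => ?_) ?_
    · obtain ⟨c, hc, rfl⟩ := Finset.mem_image.1 hi
      exact Finset.mem_Icc.2 ⟨Finset.card_pos.2 (hpos c hc), hle c hc⟩
    · rw [Finset.card_image_of_injOn, hC.2.2, Nat.card_Icc, Nat.add_sub_cancel]
      intro a ha b hb hab
      by_contra hne
      rcases hC.2.1 ha hb hne with h | h <;> have := Finset.card_lt_card h <;> simp_all
  simpa using himg.ge (Finset.mem_Icc.2 ⟨hj, hjm⟩)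

theorem exists_chain_of_faces [DecidableEq V] (s : Finset V) :
    ∃ C : Finset (Finset V), IsChainOfCard s.card {t | t.Nonempty ∧ t ⊆ s} C ∧
      (s.Nonempty → s ∈ C) := by
  induction s using Finset.induction_on with
  | empty => exact ⟨∅, ⟨by simp, by simp, rfl⟩, by simp⟩
  | insert a s ha ih =>
    obtain ⟨C, hC, -⟩ := ih
    have hs := Finset.subset_insert a s
    refine ⟨insert (insert a s) C, ?_, fun _ => Finset.mem_insert_self _ _⟩
    rw [Finset.card_insert_of_notMem ha]
    refine IsChainOfCard.insert_of_mem_chainNbhd ⟨fun t ht => ⟨(hC.1 ht).1, (hC.1 ht).2.trans hs⟩, hC.2⟩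
      ⟨⟨Finset.insert_nonempty a s, subset_rfl⟩, fun c hc => Or.inr ?_⟩
    exact lt_of_le_of_lt (hC.1 hc).2 (Finset.ssubset_insert ha)

variable [DecidableEq V] {X : Set (Finset V)} {m : ℕ}

theorem IsSimplicialComplex.exists_chain (hsc : IsSimplicialComplex X) {s : Finset V}
    (hs : s ∈ X) :
    ∃ C : Finset (Finset V), IsChainOfCard s.card X C ∧ s ∈ C ∧ ∀ c ∈ C, c ⊆ s := by
  obtain ⟨C, hC, hsC⟩ := exists_chain_of_faces s
  exact ⟨C, ⟨fun t ht => hsc.2.2.1 s hs t (hC.1 ht).1 (hC.1 ht).2, hC.2⟩, hsC (hsc.2.1 s hs),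
    fun c hc => (hC.1 hc).2⟩

theorem IsThinAux.card_simplex_le (hX : IsThinAux m X) (hsc : IsSimplicialComplex X)
    {s : Finset V} (hs : s ∈ X) : s.card ≤ m := by
  obtain ⟨C, hC, -⟩ := hsc.exists_chain hs
  exact hX.card_le hC

theorem IsThinAux.exists_mem_chain_card_eq (hX : IsThinAux m X) (hsc : IsSimplicialComplex X)
    {C : Finset (Finset V)} (hC : IsChainOfCard m X C) {j : ℕ} (hj : 1 ≤ j) (hjm : j ≤ m) :
    ∃ c ∈ C, c.card = j :=
  hC.exists_card_eq (fun _ hc => hsc.2.1 _ (hC.1 hc))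
    (fun _ hc => hX.card_simplex_le hsc (hC.1 hc)) hj hjm

theorem IsThinAux.exists_superset_card_eq (hX : IsThinAux m X) (hsc : IsSimplicialComplex X)
    {s : Finset V} (hs : s ∈ X) : ∃ g ∈ X, s ⊆ g ∧ g.card = m := by
  obtain ⟨C, hC, hsC, -⟩ := hsc.exists_chain hs
  have hle := hX.card_le hC
  obtain ⟨k, rfl⟩ := Nat.exists_eq_add_of_le' hle
  obtain ⟨D, hCD, hD⟩ := hX.exists_chain_superset hC
  have hpos := Finset.card_pos.2 (hsc.2.1 s hs)
  obtain ⟨g, hg, hgc⟩ := hX.exists_mem_chain_card_eq hsc hD (by omega) le_rfl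
  refine ⟨g, hD.1 hg, ?_, hgc⟩
  by_cases hne : s = g
  · exact hne.subset
  rcases hD.2.1 (hCD hsC) hg hne with h | h
  · exact h.le
  · have := Finset.card_lt_card h
    omega

theorem IsThinAux.ncard_cofaces (hX : IsThinAux (m + 1) X) (hsc : IsSimplicialComplex X)
    {s : Finset V} (hs : s ∈ X) (hsm : s.card = m) :
    Set.ncard {g | g ∈ X ∧ s ⊆ g ∧ g.card = m + 1} ∈ ({1, 2} : Set ℕ) := by
  obtain ⟨C, hC, hsC, hCs⟩ := hsc.exists_chain hs
  rw [hsm] at hC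
  have hset : {g | g ∈ X ∧ s ⊆ g ∧ g.card = m + 1} = PCMPaper.chainNbhd X C := by
    ext g
    constructor
    · rintro ⟨hg, hsg, hgc⟩
      refine ⟨hg, fun c hc => Or.inr ?_⟩
      refine lt_of_le_of_lt (hCs c hc) (lt_of_le_of_ne hsg ?_)
      rintro rfl
      omega
    · rintro ⟨hg, hgC⟩
      have hgpos := Finset.card_pos.2 (hsc.2.1 g hg)
      have hgle := hX.card_simplex_le hsc hg
      have hgc : g.card = m + 1 := by
        by_contra hne
        obtain ⟨c, hc, hcg⟩ := hC.exists_card_eq (fun _ hc => hsc.2.1 _ (hC.1 hc))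
          (fun c hc => hsm ▸ Finset.card_le_card (hCs c hc)) hgpos (by omega)
        rcases hgC c hc with h | h <;> have := Finset.card_lt_card h <;> omega
      refine ⟨hg, ?_, hgc⟩
      rcases hgC s hsC with h | h
      · have := Finset.card_lt_card h
        omega
      · exact h.le
  rw [hset]
  rw [Nat.add_comm] at hX
  obtain ⟨x, hx⟩ | ⟨x, y, hxy, -, -, hx⟩ := hX.chainNbhd hC
  · rw [hx]
    simp
  · rw [hx, Set.ncard_pair hxy]
    simp

theorem IsThinAux.reflTransGen_rel (hX : IsThinAux (m + 1) X) (hsc : IsSimplicialComplex X)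
    (hm : 1 ≤ m) {a b : Finset V} (ha : a ∈ X) (ham : a.card = m + 1) (hb : b ∈ X)
    (hbm : b.card = m + 1) :
    Relation.ReflTransGen (rel {h | h ∈ X ∧ (h.card = m ∨ h.card = m + 1)}) a b := by
  obtain ⟨A, hA, haA, -⟩ := hsc.exists_chain ha
  obtain ⟨B, hB, hbB, -⟩ := hsc.exists_chain hb
  rw [ham] at hA
  rw [hbm] at hB
  have eq_top : ∀ {C x y}, IsChainOfCard (m + 1) X C → x ∈ C → y ∈ C → x.card = y.card →
      x = y := by
    intro C x y hC hx hy hxy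
    by_contra hne
    rcases hC.2.1 hx hy hne with h | h <;> have := Finset.card_lt_card h <;> omega
  have path := hX.reflTransGen_adjChains hA hB
  induction path generalizing b with
  | refl => rw [eq_top hA haA hbB (by omega)]
  | @tail C D _ hCD ih =>
    obtain ⟨hC, hD, E, hEC, hED, hE⟩ := hCD
    obtain ⟨c, hcC, hcm⟩ := hX.exists_mem_chain_card_eq hsc hC (j := m + 1) (by omega) le_rfl
    refine (ih (hC.1 hcC) hcm hC hcC).trans ?_
    by_cases hcD : c ∈ D
    · rw [eq_top hD hcD hbB (by omega)]
    obtain ⟨e, heC, hem⟩ := hX.exists_mem_chain_card_eq hsc hC (j := m) hm (by omega)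
    have hec : e ≠ c := by
      rintro rfl
      omega
    have hEe : E = C.erase c := by
      refine Finset.eq_of_subset_of_card_le
        (fun x hx => Finset.mem_erase.2 ⟨fun h => hcD (h ▸ hED hx), hEC hx⟩) ?_
      rw [Finset.card_erase_of_mem hcC, hC.2.2]
      omega
    have heD : e ∈ D := hED (hEe ▸ Finset.mem_erase.2 ⟨hec, heC⟩)
    have heb : e ≠ b := by
      rintro rfl
      omega
    have heX : e ∈ {h | h ∈ X ∧ (h.card = m ∨ h.card = m + 1)} := ⟨hC.1 heC, .inl hem⟩
    exact .tail (.single ⟨⟨hC.1 hcC, .inr hcm⟩, heX, hec.symm, hC.2.1 hcC heC hec.symm⟩)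
      ⟨heX, ⟨hb, .inr hbm⟩, heb, hD.2.1 heD hbB heb⟩

end Finset

/-- Let `X` be a simplicial complex of rank `n ≥ 1`.  If `X` is an
`n`-PCM or an `n`-surface, then `X` is a pseudomanifold of rank `n`. -/
theorem statement_15 {V : Type*} [DecidableEq V] (X : Set (Finset V)) (n : ℤ) (hn : 1 ≤ n)
    (hsc : IsSimplicialComplex X) (hrk : rankSet X = n)
    (hX : IsPCM n X ∨ IsSurface n X) :
    IsPseudomanifold X n := by
  obtain ⟨N, hN, hthin⟩ : ∃ N : ℕ, (N : ℤ) = n + 1 ∧ IsThinAux N X := by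
    rcases hX with ⟨N, hN, h⟩ | ⟨N, hN, h⟩
    · exact ⟨N, hN, h.isThinAux⟩
    · exact ⟨N, hN, h.isThinAux⟩
  obtain ⟨m, rfl⟩ : ∃ m, N = m + 1 := ⟨N - 1, by omega⟩
  have hdim : ∀ g : Finset V, dim g = n ↔ g.card = m + 1 := fun g => by
    unfold dim
    omega
  have hdim' : ∀ g : Finset V, dim g = n - 1 ↔ g.card = m := fun g => by
    unfold dim
    omega
  refine ⟨hsc, hrk, Or.inr ⟨hn, fun h hh => ?_, fun h hh hd => ?_, fun a ha had b hb hbd => ?_⟩⟩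
  · simpa only [hdim] using hthin.exists_superset_card_eq hsc hh
  · simpa only [hdim] using hthin.ncard_cofaces hsc hh ((hdim' h).1 hd)
  · simpa only [hdim, hdim'] using
      hthin.reflTransGen_rel hsc (by omega) ha ((hdim a).1 had) hb ((hdim b).1 hbd)

end PCMPaper
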